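/- Let c₁, c₂ be real numbers, r₁, r₂ > 0, and m₁, m₂ real numbers with c_k − r_k ≤ m_k ≤ c_k + r_k for k = 1,2, and assume (m₁−c₁)/(2r₁) > (m₂−c₂)/(2r₂). Let Ψ_k⁻¹ be the Triangular quantile function with center c_k, half-range r_k and mode m_k. Then ∫₀¹ (Ψ₁⁻¹(t) − Ψ₂⁻¹(t))² dt = (c₁−c₂)² + (1/6)(r₁−r₂)² + (1/6)(m₁−c₁)² + (1/6)(m₂−c₂)² − (5/3)r₁r₂ + (2/3)(m₁−c₁)(c₁−c₂−r₂) − (2/3)(m₂−c₂)(c₁−c₂−r₁) + (1/6)·√(r₁r₂(m₁−c₁+r₁)(m₂−c₂+r₂))·(5 − (m₂−c₂)/r₂) + (1/6)·√(r₁r₂(c₁+r₁−m₁)(c₂+r₂−m₂))·(5 + (m₁−c₁)/r₁) + (1/2)·√(r₁r₂(c₂+r₂−m₂)(m₁−c₁+r₁))·(arcsin((m₁−c₁)/r₁) − arcsin((m₂−c₂)/r₂)). -/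

import Mathlib

open MeasureTheory Real

/-- The Triangular quantile function of the interval with center `c`, half-range `r`
and mode `m`. -/
noncomputable def triQuantileCR (c r m : ℝ) (t : ℝ) : ℝ :=
  if t ≤ (m - c) / (2 * r) + 1 / 2 then c - r + Real.sqrt (2 * r * (m - c + r) * t)
  else c + r - Real.sqrt (2 * r * (c + r - m) * (1 - t))

noncomputable def triAux (d e f t : ℝ) : ℝ :=
  d ^ 2 * t + e ^ 2 * (t ^ 2 / 2) - f ^ 2 * ((1 - t) ^ 2 / 2) + 4 / 3 * d * e * (t * √t)
    - 4 / 3 * d * f * ((1 - t) * √(1 - t))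
    + 2 * e * f * (1 / 4 * (2 * t - 1) * (√t * √(1 - t)) + 1 / 8 * Real.arcsin (2 * t - 1))

lemma triAux_hasDerivAt (d e f t : ℝ) (h0 : 0 < t) (h1 : t < 1) :
    HasDerivAt (triAux d e f) ((d + e * √t + f * √(1 - t)) ^ 2) t := by
  have h1' : 0 < 1 - t := by linarith
  have hid := hasDerivAt_id' t
  have hs : HasDerivAt (fun t : ℝ => √t) (1 / (2 * √t)) t := Real.hasDerivAt_sqrt h0.ne'
  have hsub : HasDerivAt (fun t : ℝ => 1 - t) (-1) t := by simpa using hid.const_sub 1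
  have hw : HasDerivAt (fun t : ℝ => √(1 - t)) (-1 / (2 * √(1 - t))) t := hsub.sqrt h1'.ne'
  have hl : HasDerivAt (fun t : ℝ => 2 * t - 1) 2 t := by
    simpa using (hid.const_mul 2).sub_const 1
  have ha : HasDerivAt (fun t : ℝ => Real.arcsin (2 * t - 1))
      (1 / √(1 - (2 * t - 1) ^ 2) * 2) t :=
    (Real.hasDerivAt_arcsin (by linarith) (by linarith)).comp t hl
  have hsq : √(1 - (2 * t - 1) ^ 2) = 2 * (√t * √(1 - t)) := by
    rw [← Real.sqrt_mul h0.le, show 1 - (2 * t - 1) ^ 2 = 2 ^ 2 * (t * (1 - t)) by ring,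
      Real.sqrt_mul (by norm_num), Real.sqrt_sq (by norm_num)]
  rw [hsq] at ha
  have H := ((((hid.const_mul (d ^ 2)).add (((hid.pow 2).div_const 2).const_mul (e ^ 2))).sub
    (((hsub.pow 2).div_const 2).const_mul (f ^ 2))).add
    ((hid.mul hs).const_mul (4 / 3 * d * e))).sub ((hsub.mul hw).const_mul (4 / 3 * d * f)) |>.add
    ((((hl.const_mul (1 / 4)).mul (hs.mul hw)).add (ha.const_mul (1 / 8))).const_mul (2 * e * f))
  refine HasDerivAt.congr_deriv (f := triAux d e f) H ?_
  have ps : 0 < √t := Real.sqrt_pos.2 h0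
  have pw : 0 < √(1 - t) := Real.sqrt_pos.2 h1'
  have es : √t ^ 2 = t := Real.sq_sqrt h0.le
  have ew : √(1 - t) ^ 2 = 1 - t := Real.sq_sqrt h1'.le
  simp only [Pi.mul_apply, Pi.pow_apply]
  generalize √(1 - t) = w at *
  generalize √t = s at *
  subst es
  have hw2 : w ^ 2 = 1 - s ^ 2 := ew
  simp only [Nat.cast_ofNat]
  field_simp
  grind

lemma triAux_integral (d e f u v : ℝ) (h0 : 0 ≤ u) (huv : u ≤ v) (h1 : v ≤ 1) :
    ∫ t in u..v, (d + e * √t + f * √(1 - t)) ^ 2 = triAux d e f v - triAux d e f u := by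
  apply intervalIntegral.integral_eq_sub_of_hasDerivAt_of_le huv
  · unfold triAux
    have := Real.continuous_arcsin
    fun_prop
  · intro t ht
    exact triAux_hasDerivAt d e f t (by linarith [ht.1]) (by linarith [ht.2])
  · apply Continuous.intervalIntegrable
    fun_prop

lemma tri_left (c r p t : ℝ) (hr : 0 < r) (hp : 0 ≤ p) (h : t ≤ p) :
    triQuantileCR c r (c + r * (2 * p - 1)) t = c - r + 2 * r * √p * √t := by
  have e : (c + r * (2 * p - 1) - c) / (2 * r) + 1 / 2 = p := by field_simp; ring
  unfold triQuantileCR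
  rw [e, if_pos h, show 2 * r * (c + r * (2 * p - 1) - c + r) * t = (2 * r) ^ 2 * (p * t) by ring,
    Real.sqrt_mul (by positivity), Real.sqrt_sq (by positivity), Real.sqrt_mul hp]
  ring

lemma tri_right (c r p t : ℝ) (hr : 0 < r) (hp : p ≤ 1) (h : p < t) :
    triQuantileCR c r (c + r * (2 * p - 1)) t = c + r - 2 * r * √(1 - p) * √(1 - t) := by
  have e : (c + r * (2 * p - 1) - c) / (2 * r) + 1 / 2 = p := by field_simp; ring
  unfold triQuantileCR
  rw [e, if_neg h.not_ge, show 2 * r * (c + r - (c + r * (2 * p - 1))) * (1 - t)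
      = (2 * r) ^ 2 * ((1 - p) * (1 - t)) by ring,
    Real.sqrt_mul (by positivity), Real.sqrt_sq (by positivity), Real.sqrt_mul (by linarith)]
  ring

lemma tri_piece (g : ℝ → ℝ) (d e f u v : ℝ) (h0 : 0 ≤ u) (huv : u ≤ v) (h1 : v ≤ 1)
    (hg : ∀ t, u < t → t ≤ v → g t = (d + e * √t + f * √(1 - t)) ^ 2) :
    IntervalIntegrable g volume u v ∧ ∫ t in u..v, g t = triAux d e f v - triAux d e f u := by
  have hE : Set.EqOn (fun t => (d + e * √t + f * √(1 - t)) ^ 2) g (Set.uIoc u v) := by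
    intro t ht
    rw [Set.uIoc_of_le huv] at ht
    exact (hg t ht.1 ht.2).symm
  constructor
  · apply IntervalIntegrable.congr hE
    apply Continuous.intervalIntegrable
    fun_prop
  · rw [← triAux_integral d e f u v h0 huv h1]
    symm
    apply intervalIntegral.integral_congr_ae
    exact Filter.Eventually.of_forall fun t ht => hE ht

lemma sqrt_aux (a b x y : ℝ) (ha : 0 < a) (hb : 0 < b) (hx : 0 ≤ x) :
    √(a * b * (2 * a * x) * (2 * b * y)) = 2 * a * b * (√x * √y) := by
  rw [show a * b * (2 * a * x) * (2 * b * y) = (2 * a * b) ^ 2 * (x * y) by ring,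
    Real.sqrt_mul (by positivity), Real.sqrt_sq (by positivity), Real.sqrt_mul hx]

theorem mallows_triangular_case2 (c₁ c₂ r₁ r₂ m₁ m₂ : ℝ)
    (hr₁ : 0 < r₁) (hr₂ : 0 < r₂)
    (hm₁l : c₁ - r₁ ≤ m₁) (hm₁u : m₁ ≤ c₁ + r₁)
    (hm₂l : c₂ - r₂ ≤ m₂) (hm₂u : m₂ ≤ c₂ + r₂)
    (hord : (m₁ - c₁) / (2 * r₁) > (m₂ - c₂) / (2 * r₂)) :
    ∫ t in (0 : ℝ)..1, (triQuantileCR c₁ r₁ m₁ t - triQuantileCR c₂ r₂ m₂ t) ^ 2 =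
      (c₁ - c₂) ^ 2 + (1 / 6) * (r₁ - r₂) ^ 2 + (1 / 6) * (m₁ - c₁) ^ 2 +
        (1 / 6) * (m₂ - c₂) ^ 2 - (5 / 3) * r₁ * r₂ +
        (2 / 3) * (m₁ - c₁) * (c₁ - c₂ - r₂) - (2 / 3) * (m₂ - c₂) * (c₁ - c₂ - r₁) +
        (1 / 6) * Real.sqrt (r₁ * r₂ * (m₁ - c₁ + r₁) * (m₂ - c₂ + r₂)) *
          (5 - (m₂ - c₂) / r₂) +
        (1 / 6) * Real.sqrt (r₁ * r₂ * (c₁ + r₁ - m₁) * (c₂ + r₂ - m₂)) *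
          (5 + (m₁ - c₁) / r₁) +
        (1 / 2) * Real.sqrt (r₁ * r₂ * (c₂ + r₂ - m₂) * (m₁ - c₁ + r₁)) *
          (Real.arcsin ((m₁ - c₁) / r₁) - Real.arcsin ((m₂ - c₂) / r₂)) := by
  obtain ⟨p, hp⟩ : ∃ p, p = (m₁ - c₁) / (2 * r₁) + 1 / 2 := ⟨_, rfl⟩
  obtain ⟨q, hq⟩ : ∃ q, q = (m₂ - c₂) / (2 * r₂) + 1 / 2 := ⟨_, rfl⟩
  have hqp : q < p := by linarith
  have em₁ : m₁ = c₁ + r₁ * (2 * p - 1) := by rw [hp]; field_simp; ring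
  have em₂ : m₂ = c₂ + r₂ * (2 * q - 1) := by rw [hq]; field_simp; ring
  clear hp hq hord
  subst em₁ em₂
  have hp1 : p ≤ 1 := by nlinarith
  have hq0 : 0 ≤ q := by nlinarith
  have hp0 : 0 ≤ p := by linarith
  have hq1 : q ≤ 1 := by linarith
  clear hm₁l hm₁u hm₂l hm₂u
  obtain ⟨iA, vA⟩ := tri_piece (fun t => (triQuantileCR c₁ r₁ (c₁ + r₁ * (2 * p - 1)) t -
      triQuantileCR c₂ r₂ (c₂ + r₂ * (2 * q - 1)) t) ^ 2)
    (c₁ - r₁ - c₂ + r₂) (2 * r₁ * √p - 2 * r₂ * √q) 0 0 q le_rfl hq0 hq1 (by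
      intro t h h'
      rw [tri_left _ _ _ _ hr₁ hp0 (by linarith), tri_left _ _ _ _ hr₂ hq0 h']
      ring)
  obtain ⟨iB, vB⟩ := tri_piece (fun t => (triQuantileCR c₁ r₁ (c₁ + r₁ * (2 * p - 1)) t -
      triQuantileCR c₂ r₂ (c₂ + r₂ * (2 * q - 1)) t) ^ 2)
    (c₁ - r₁ - c₂ - r₂) (2 * r₁ * √p) (2 * r₂ * √(1 - q)) q p hq0 hqp.le hp1 (by
      intro t h h'
      rw [tri_left _ _ _ _ hr₁ hp0 h', tri_right _ _ _ _ hr₂ hq1 h]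
      ring)
  obtain ⟨iC, vC⟩ := tri_piece (fun t => (triQuantileCR c₁ r₁ (c₁ + r₁ * (2 * p - 1)) t -
      triQuantileCR c₂ r₂ (c₂ + r₂ * (2 * q - 1)) t) ^ 2)
    (c₁ + r₁ - c₂ - r₂) 0 (2 * r₂ * √(1 - q) - 2 * r₁ * √(1 - p)) p 1 hp0 hp1 le_rfl (by
      intro t h h'
      rw [tri_right _ _ _ _ hr₁ hp1 h, tri_right _ _ _ _ hr₂ hq1 (by linarith)]
      ring)
  rw [← intervalIntegral.integral_add_adjacent_intervals (iA.trans iB) iC,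
    ← intervalIntegral.integral_add_adjacent_intervals iA iB, vA, vB, vC]
  have e1 : c₁ + r₁ * (2 * p - 1) - c₁ + r₁ = 2 * r₁ * p := by ring
  have e2 : c₂ + r₂ * (2 * q - 1) - c₂ + r₂ = 2 * r₂ * q := by ring
  have e3 : c₁ + r₁ - (c₁ + r₁ * (2 * p - 1)) = 2 * r₁ * (1 - p) := by ring
  have e4 : c₂ + r₂ - (c₂ + r₂ * (2 * q - 1)) = 2 * r₂ * (1 - q) := by ring
  have e5 : c₁ + r₁ * (2 * p - 1) - c₁ = r₁ * (2 * p - 1) := by ring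
  have e6 : c₂ + r₂ * (2 * q - 1) - c₂ = r₂ * (2 * q - 1) := by ring
  have e7 : r₁ * (2 * p - 1) / r₁ = 2 * p - 1 := by field_simp
  have e8 : r₂ * (2 * q - 1) / r₂ = 2 * q - 1 := by field_simp
  rw [e1, e2, e3, e4, e5, e6, e7, e8, sqrt_aux _ _ _ _ hr₁ hr₂ hp0,
    sqrt_aux _ _ _ _ hr₁ hr₂ (by linarith : 0 ≤ 1 - p), mul_comm r₁ r₂,
    sqrt_aux _ _ _ _ hr₂ hr₁ (by linarith : 0 ≤ 1 - q)]
  unfold triAux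
  have f1 : √p ^ 2 = p := Real.sq_sqrt hp0
  have f2 : √q ^ 2 = q := Real.sq_sqrt hq0
  have f3 : √(1 - p) ^ 2 = 1 - p := Real.sq_sqrt (by linarith)
  have f4 : √(1 - q) ^ 2 = 1 - q := Real.sq_sqrt (by linarith)
  simp only [sub_self, sub_zero, Real.sqrt_zero, Real.sqrt_one]
  clear vA vB vC iA iB iC e1 e2 e3 e4 e5 e6 e7 e8
  generalize Real.arcsin (2 * p - 1) = A
  generalize Real.arcsin (2 * q - 1) = B
  generalize √(1 - p) = w at *
  generalize √(1 - q) = z at *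
  generalize √p = s at *
  generalize √q = y at *
  subst f1 f2
  have f3 : w ^ 2 = 1 - s ^ 2 := f3
  grind
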